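/- arXiv:2506.20925 — 3 statements merged into one kernel-verified Lean document; each statement's English description precedes it below -/
import Mathlib

section
/- Suppose F_l(c) < ‖F_l − F_h‖, let κ be the unique solution of the κ-system at (c, α) with κ⁴ < v⋆ < κ⁵, and let ρ⋆ be the coupling defined from the kernel γ⋆ by ρ⋆(A × B) = ∫_B γ⋆(v_h)(A) dμ_h(v_h). Then for every point (v_l, v_h) in the topological support of ρ⋆, φ⋆(v_l) + ψ⋆(v_h) = π(v_l, v_h). -/
open MeasureTheory Set Filter

noncomputable section

/-- The cumulative distribution function of a Borel measure on `ℝ`. -/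
def mCdf (μ : Measure ℝ) (v : ℝ) : ℝ := (μ (Iic v)).toReal

/-- Total variation distance between two measures on `ℝ`:
the supremum over Borel sets `A` of `|μ A - ν A|`. -/
def tvDist (μ ν : Measure ℝ) : ℝ :=
  sSup {x : ℝ | ∃ A : Set ℝ, MeasurableSet A ∧ x = |(μ A).toReal - (ν A).toReal|}

/-- Generalized inverse of a CDF: `F⁻¹ q = inf {v | q ≤ F v}`. -/
def invCdf (F : ℝ → ℝ) (q : ℝ) : ℝ := sInf {v : ℝ | q ≤ F v}

/-- `ρ` is a coupling of `(μ, ν)` iff its marginals are `μ` and `ν`. -/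
def IsCoupling (μ ν : Measure ℝ) (ρ : Measure (ℝ × ℝ)) : Prop :=
  ρ.fst = μ ∧ ρ.snd = ν

/-- The market primitives: probability measures `μl, μh` on `ℝ` with densities
`fl, fh` positive exactly on a common interval `(vlo, vhi)` (with `vhi` possibly `∞`),
and a strictly increasing likelihood ratio `fh / fl` on that interval. -/
structure MarketData where
  μl : Measure ℝ
  μh : Measure ℝ
  fl : ℝ → ℝ
  fh : ℝ → ℝ
  vlo : ℝ
  vhi : EReal
  probl : IsProbabilityMeasure μl
  probh : IsProbabilityMeasure μh
  meas_fl : Measurable fl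
  meas_fh : Measurable fh
  dens_l : μl = volume.withDensity (fun v => ENNReal.ofReal (fl v))
  dens_h : μh = volume.withDensity (fun v => ENNReal.ofReal (fh v))
  vlo_nonneg : 0 ≤ vlo
  vlo_lt_vhi : (vlo : EReal) < vhi
  fl_nonneg : ∀ v, 0 ≤ fl v
  fh_nonneg : ∀ v, 0 ≤ fh v
  fl_pos_iff : ∀ v : ℝ, 0 < fl v ↔ (vlo < v ∧ (v : EReal) < vhi)
  fh_pos_iff : ∀ v : ℝ, 0 < fh v ↔ (vlo < v ∧ (v : EReal) < vhi)
  lr_strictMono : StrictMonoOn (fun v => fh v / fl v) {v : ℝ | vlo < v ∧ (v : EReal) < vhi}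

/-- CDF of the `l`-group. -/
def MarketData.Fl (D : MarketData) : ℝ → ℝ := mCdf D.μl

/-- CDF of the `h`-group. -/
def MarketData.Fh (D : MarketData) : ℝ → ℝ := mCdf D.μh

/-- `Δ v = F_l v − F_h v`. -/
def MarketData.Δ (D : MarketData) (v : ℝ) : ℝ := D.Fl v - D.Fh v

/-- `vstar` is the unique maximizer of `Δ`, characterized by `f_l vstar = f_h vstar`. -/
def IsVStar (D : MarketData) (vstar : ℝ) : Prop :=
  D.fl vstar = D.fh vstar ∧ (∀ v, D.Δ v ≤ D.Δ vstar) ∧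
  (∀ v, (∀ w, D.Δ w ≤ D.Δ v) → v = vstar)

/-- A vector `κ = (κ¹, κ², κ³, κ⁴, κ⁵) ∈ ℝ⁵`. -/
structure Kappa where
  k1 : ℝ
  k2 : ℝ
  k3 : ℝ
  k4 : ℝ
  k5 : ℝ

/-- The κ-system at `(c, α)` for the pair of CDFs `(Fl, Fh)`:
`κ¹ ≤ κ² ≤ κ³ ≤ κ⁴ ≤ κ⁵`,
`κ² = Fl⁻¹(Δ κ³ + Fh κ¹) = Fl⁻¹(Δ κ⁴) = Fl⁻¹(Δ κ⁵)` and
`κ¹ − c = (1 − α)(κ³ − c) = α (κ⁵ − κ⁴)`. -/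
def KappaSystem (Fl Fh : ℝ → ℝ) (c α : ℝ) (κ : Kappa) : Prop :=
  κ.k1 ≤ κ.k2 ∧ κ.k2 ≤ κ.k3 ∧ κ.k3 ≤ κ.k4 ∧ κ.k4 ≤ κ.k5 ∧
  κ.k2 = invCdf Fl ((Fl κ.k3 - Fh κ.k3) + Fh κ.k1) ∧
  κ.k2 = invCdf Fl (Fl κ.k4 - Fh κ.k4) ∧
  κ.k2 = invCdf Fl (Fl κ.k5 - Fh κ.k5) ∧
  κ.k1 - c = (1 - α) * (κ.k3 - c) ∧
  κ.k1 - c = α * (κ.k5 - κ.k4)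

/-- The pairwise profit from a matched pair `(v_l, v_h)`:
`max { min{v_l,v_h} − c, α(v_h − c)⁺, (1−α)(v_l − c)⁺ }`. -/
def pairProfit (c α vl vh : ℝ) : ℝ :=
  max (min vl vh - c) (max (α * max (vh - c) 0) ((1 - α) * max (vl - c) 0))

/-- The set of matched-pair profit values achievable by couplings of `(μl, μh)`. -/
def couplingValues (μl μh : Measure ℝ) (c α : ℝ) : Set ℝ :=
  {x : ℝ | ∃ ρ : Measure (ℝ × ℝ), IsCoupling μl μh ρ ∧
    x = ∫ p, pairProfit c α p.1 p.2 ∂ρ}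

/-- The smaller solution of `Δ v = q` (the generalized inverse of `Δ` on its
increasing part): `Δ̲⁻¹ q = inf {v | q ≤ Δ v}`. -/
def lowerDeltaInv (Δfn : ℝ → ℝ) (q : ℝ) : ℝ := sInf {v : ℝ | q ≤ Δfn v}

/-- The larger solution of `Δ v = q`: `Δ̄⁻¹ q = sup {v | q ≤ Δ v}`. -/
def upperDeltaInv (Δfn : ℝ → ℝ) (q : ℝ) : ℝ := sSup {v : ℝ | q ≤ Δfn v}

/-- The Markov kernel `γ⋆` describing the optimal matching of `l`-values to each
`h`-value `v_h`. -/
def gammaStar (D : MarketData) (κ : Kappa) (vh : ℝ) : Measure ℝ :=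
  if vh ≤ κ.k1 then
    Measure.dirac (lowerDeltaInv D.Δ (D.Fh vh + D.Δ κ.k3))
  else if vh ≤ κ.k3 then
    Measure.dirac (invCdf D.Fl (D.Fh vh + D.Δ κ.k3))
  else if vh ≤ κ.k4 then
    Measure.dirac vh
  else if vh ≤ κ.k5 then
    Measure.dirac (invCdf D.Fl (D.Fh vh + D.Δ κ.k4))
  else
    ENNReal.ofReal (D.fl vh / D.fh vh) • Measure.dirac vh +
      ENNReal.ofReal (1 - D.fl vh / D.fh vh) •
        Measure.dirac (invCdf D.Fl (D.Δ κ.k5 - D.Δ vh))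

/-- The dual variable `φ⋆`. -/
def phiStar (c α k1 k3 k4 k5 : ℝ) (vl : ℝ) : ℝ :=
  if vl ≤ k3 then k1 - c
  else if vl ≤ k4 then (1 - α) * (vl - c)
  else if vl ≤ k5 then vl - c - α * (k4 - c)
  else (1 - α) * (vl - c) + (k1 - c)

/-- The dual variable `ψ⋆`. -/
def psiStar (c α k1 k3 k4 k5 : ℝ) (vh : ℝ) : ℝ :=
  if vh ≤ k1 then 0
  else if vh ≤ k3 then vh - k1
  else if vh ≤ k4 then α * (vh - c)
  else if vh ≤ k5 then α * (k4 - c)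
  else α * (vh - c) - (k1 - c)

/-- The topological support of a measure: points all of whose open neighborhoods
have positive measure. -/
def measSupport {X : Type*} [TopologicalSpace X] [MeasurableSpace X]
    (μ : Measure X) : Set X :=
  {x | ∀ U : Set X, IsOpen U → x ∈ U → 0 < μ U}

section Cdf

variable {μ : Measure ℝ}

lemma mCdf_sub_eq [IsFiniteMeasure μ] {a b : ℝ} (hab : a ≤ b) :
    mCdf μ b - mCdf μ a = μ.real (Ioc a b) := by
  have h := measureReal_union (μ := μ) (Iic_disjoint_Ioc (le_refl a)) (measurableSet_Ioc (b := b))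
  rw [Iic_union_Ioc_eq_Iic hab] at h
  change μ.real (Iic b) - μ.real (Iic a) = _
  linarith

lemma mCdf_mono [IsFiniteMeasure μ] : Monotone (mCdf μ) := fun a b hab => by
  have h := mCdf_sub_eq (μ := μ) hab
  have : 0 ≤ μ.real (Ioc a b) := measureReal_nonneg
  linarith

lemma mCdf_nonneg (v : ℝ) : 0 ≤ mCdf μ v := ENNReal.toReal_nonneg

lemma mCdf_eq_one_sub [IsProbabilityMeasure μ] (v : ℝ) : mCdf μ v = 1 - μ.real (Ioi v) := by
  have h := probReal_compl_eq_one_sub (μ := μ) (measurableSet_Iic (a := v))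
  rw [compl_Iic] at h
  change μ.real (Iic v) = _
  linarith

lemma continuous_mCdf [IsProbabilityMeasure μ] [NullSingletonClass μ] : Continuous (mCdf μ) := by
  have hF : mCdf μ = ProbabilityTheory.cdf μ := by
    ext v
    exact (ProbabilityTheory.cdf_eq_real μ v).symm
  rw [hF, continuous_iff_continuousAt]
  intro x
  rw [(ProbabilityTheory.cdf μ).mono.continuousAt_iff_leftLim_eq_rightLim,
    StieltjesFunction.rightLim_eq]
  have h := (ProbabilityTheory.cdf μ).measure_singleton x
  rw [ProbabilityTheory.measure_cdf, measure_singleton] at h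
  exact le_antisymm ((ProbabilityTheory.cdf μ).mono.leftLim_le le_rfl)
    (sub_nonpos.mp (ENNReal.ofReal_eq_zero.mp h.symm))

end Cdf

section GeneralizedInverse

variable {F : ℝ → ℝ} {a q : ℝ}

lemma bddBelow_superlevel (hF : Monotone F) (ha : F a < q) : BddBelow {v | q ≤ F v} :=
  ⟨a, fun _ hv => (hF.reflect_lt (ha.trans_le hv)).le⟩

lemma apply_invCdf (hF : Monotone F) (hcont : Continuous F) (ha : F a < q)
    (hne : {v | q ≤ F v}.Nonempty) : F (invCdf F q) = q := by
  have hb := bddBelow_superlevel hF ha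
  refine le_antisymm ?_ ((isClosed_le continuous_const hcont).csInf_mem hne hb)
  refine le_of_tendsto (hcont.continuousAt.tendsto.mono_left nhdsWithin_le_nhds :
    Tendsto F (nhdsWithin (invCdf F q) (Iio (invCdf F q))) _) ?_
  filter_upwards [self_mem_nhdsWithin] with v hv
  exact (not_le.mp fun h => (not_lt.mpr (csInf_le hb h)) hv).le

/-- A positive value of the generalized inverse rules out the junk value `0`. -/
lemma apply_invCdf_of_pos (hF : Monotone F) (hcont : Continuous F) (hnonneg : ∀ v, 0 ≤ F v)
    (ha : F a = 0) (hpos : 0 < invCdf F q) : 0 < q ∧ F (invCdf F q) = q := by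
  have hq : 0 < q := by
    by_contra! hq
    have : {v | q ≤ F v} = univ := eq_univ_of_forall fun v => hq.trans (hnonneg v)
    rw [invCdf, this, Real.sInf_univ] at hpos
    exact hpos.false
  refine ⟨hq, apply_invCdf hF hcont (ha.trans_lt hq) ?_⟩
  by_contra! hne
  rw [invCdf, hne, Real.sInf_empty] at hpos
  exact hpos.false

end GeneralizedInverse

section Density

variable {f g : ℝ → ℝ}

lemma withDensity_mono_on {S : Set ℝ} (hS : MeasurableSet S) (h : ∀ v ∈ S, f v ≤ g v) :
    volume.withDensity (fun v => ENNReal.ofReal (f v)) S ≤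
      volume.withDensity (fun v => ENNReal.ofReal (g v)) S := by
  rw [withDensity_apply _ hS, withDensity_apply _ hS]
  exact setLIntegral_mono' hS fun v hv => ENNReal.ofReal_le_ofReal (h v hv)

lemma withDensity_eq_zero_on {S : Set ℝ} (hS : MeasurableSet S) (h : ∀ v ∈ S, f v = 0) :
    volume.withDensity (fun v => ENNReal.ofReal (f v)) S = 0 := by
  rw [withDensity_apply _ hS, setLIntegral_congr_fun hS (g := fun _ => 0)
    fun v hv => by simp [h v hv]]
  simp

lemma withDensity_Ioc_pos (hf : Measurable f) {a b : ℝ} (hab : a < b)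
    (h : ∀ v ∈ Ioc a b, 0 < f v) :
    0 < volume.withDensity (fun v => ENNReal.ofReal (f v)) (Ioc a b) := by
  rw [pos_iff_ne_zero, Ne, withDensity_apply_eq_zero hf.ennreal_ofReal]
  have : {x | ENNReal.ofReal (f x) ≠ 0} ∩ Ioc a b = Ioc a b :=
    inter_eq_right.mpr fun v hv => by simpa using h v hv
  rw [this, Real.volume_Ioc]
  simpa using hab

end Density

namespace MarketData

variable (D : MarketData)

instance : IsProbabilityMeasure D.μl := D.probl
instance : IsProbabilityMeasure D.μh := D.probh
instance : NullSingletonClass D.μl := by rw [D.dens_l]; infer_instance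

lemma Fl_mono : Monotone D.Fl := mCdf_mono
lemma Fh_mono : Monotone D.Fh := mCdf_mono
lemma continuous_Fl : Continuous D.Fl := continuous_mCdf

lemma fl_eq_zero {v : ℝ} (h : ¬(D.vlo < v ∧ (v : EReal) < D.vhi)) : D.fl v = 0 :=
  le_antisymm (not_lt.mp (mt (D.fl_pos_iff v).mp h)) (D.fl_nonneg v)

lemma fh_eq_zero {v : ℝ} (h : ¬(D.vlo < v ∧ (v : EReal) < D.vhi)) : D.fh v = 0 :=
  le_antisymm (not_lt.mp (mt (D.fh_pos_iff v).mp h)) (D.fh_nonneg v)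

lemma ae_mem_interval : ∀ᵐ v ∂D.μh, D.vlo < v ∧ (v : EReal) < D.vhi := by
  rw [D.dens_h, ae_withDensity_iff D.meas_fh.ennreal_ofReal]
  refine Eventually.of_forall fun v hv => (D.fh_pos_iff v).mp ?_
  simpa using hv

lemma Fl_eq_zero {v : ℝ} (h : v ≤ D.vlo) : D.Fl v = 0 := by
  have : D.μl (Iic v) = 0 := by
    rw [D.dens_l]
    exact withDensity_eq_zero_on measurableSet_Iic fun w hw =>
      D.fl_eq_zero fun hw' => (hw'.1.trans_le (le_trans hw h)).false
  rw [Fl, mCdf, this, ENNReal.toReal_zero]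

lemma Fh_eq_zero {v : ℝ} (h : v ≤ D.vlo) : D.Fh v = 0 := by
  have : D.μh (Iic v) = 0 := by
    rw [D.dens_h]
    exact withDensity_eq_zero_on measurableSet_Iic fun w hw =>
      D.fh_eq_zero fun hw' => (hw'.1.trans_le (le_trans hw h)).false
  rw [Fh, mCdf, this, ENNReal.toReal_zero]

lemma Fl_eq_one {v : ℝ} (h : D.vhi ≤ v) : D.Fl v = 1 := by
  have : D.μl (Ioi v) = 0 := by
    rw [D.dens_l]
    exact withDensity_eq_zero_on measurableSet_Ioi fun w hw =>
      D.fl_eq_zero fun hw' => (hw'.2.trans_le (h.trans (EReal.coe_le_coe (le_of_lt hw)))).false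
  rw [Fl, mCdf_eq_one_sub, measureReal_def, this, ENNReal.toReal_zero, sub_zero]

lemma Fh_eq_one {v : ℝ} (h : D.vhi ≤ v) : D.Fh v = 1 := by
  have : D.μh (Ioi v) = 0 := by
    rw [D.dens_h]
    exact withDensity_eq_zero_on measurableSet_Ioi fun w hw =>
      D.fh_eq_zero fun hw' => (hw'.2.trans_le (h.trans (EReal.coe_le_coe (le_of_lt hw)))).false
  rw [Fh, mCdf_eq_one_sub, measureReal_def, this, ENNReal.toReal_zero, sub_zero]

lemma Fl_lt {a b : ℝ} (hab : a < b) (hb : D.vlo < b ∧ (b : EReal) < D.vhi) :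
    D.Fl a < D.Fl b := by
  have hpos : 0 < D.μl (Ioc (max a D.vlo) b) := by
    rw [D.dens_l]
    exact withDensity_Ioc_pos D.meas_fl (max_lt hab hb.1) fun v hv => (D.fl_pos_iff v).mpr
      ⟨(le_max_right _ _).trans_lt hv.1, (EReal.coe_le_coe hv.2).trans_lt hb.2⟩
  have h := mCdf_sub_eq (μ := D.μl) hab.le
  have : 0 < D.μl.real (Ioc a b) := ENNReal.toReal_pos
    (hpos.trans_le (measure_mono (Ioc_subset_Ioc_left (le_max_left _ _)))).ne' (measure_ne_top _ _)
  simp only [Fl]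
  linarith

lemma Fh_lt {a b : ℝ} (hab : a < b) (hb : D.vlo < b ∧ (b : EReal) < D.vhi) :
    D.Fh a < D.Fh b := by
  have hpos : 0 < D.μh (Ioc (max a D.vlo) b) := by
    rw [D.dens_h]
    exact withDensity_Ioc_pos D.meas_fh (max_lt hab hb.1) fun v hv => (D.fh_pos_iff v).mpr
      ⟨(le_max_right _ _).trans_lt hv.1, (EReal.coe_le_coe hv.2).trans_lt hb.2⟩
  have h := mCdf_sub_eq (μ := D.μh) hab.le
  have : 0 < D.μh.real (Ioc a b) := ENNReal.toReal_pos
    (hpos.trans_le (measure_mono (Ioc_subset_Ioc_left (le_max_left _ _)))).ne' (measure_ne_top _ _)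
  simp only [Fh]
  linarith

lemma mem_interval_of_Δ_pos {v : ℝ} (h : 0 < D.Δ v) : D.vlo < v ∧ (v : EReal) < D.vhi := by
  constructor
  · by_contra! hv
    simp [Δ, D.Fl_eq_zero hv, D.Fh_eq_zero hv] at h
  · by_contra! hv
    simp [Δ, D.Fl_eq_one hv, D.Fh_eq_one hv] at h

section Crossing

variable {D} {m : ℝ}

lemma fh_le_fl (hm : D.vlo < m ∧ (m : EReal) < D.vhi) (heq : D.fl m = D.fh m)
    {v : ℝ} (hv : v ≤ m) : D.fh v ≤ D.fl v := by
  by_cases h : D.vlo < v ∧ (v : EReal) < D.vhi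
  · have := D.lr_strictMono.monotoneOn h hm hv
    rwa [← heq,
      div_self ((D.fl_pos_iff m).mpr hm).ne', div_le_one ((D.fl_pos_iff v).mpr h)] at this
  · rw [D.fh_eq_zero h]
    exact D.fl_nonneg v

lemma fl_le_fh (hm : D.vlo < m ∧ (m : EReal) < D.vhi) (heq : D.fl m = D.fh m)
    {v : ℝ} (hv : m ≤ v) : D.fl v ≤ D.fh v := by
  by_cases h : D.vlo < v ∧ (v : EReal) < D.vhi
  · have := D.lr_strictMono.monotoneOn hm h hv
    rwa [← heq,
      div_self ((D.fl_pos_iff m).mpr hm).ne', one_le_div ((D.fl_pos_iff v).mpr h)] at this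
  · rw [D.fl_eq_zero h]
    exact D.fh_nonneg v

lemma Δ_monotoneOn (hm : D.vlo < m ∧ (m : EReal) < D.vhi) (heq : D.fl m = D.fh m) :
    MonotoneOn D.Δ (Iic m) := by
  intro a _ b hb hab
  have h : D.μh (Ioc a b) ≤ D.μl (Ioc a b) := by
    rw [D.dens_l, D.dens_h]
    exact withDensity_mono_on measurableSet_Ioc fun v hv => fh_le_fl hm heq (hv.2.trans hb)
  have h' : D.μh.real (Ioc a b) ≤ D.μl.real (Ioc a b) :=
    ENNReal.toReal_mono (measure_ne_top _ _) h
  rw [← mCdf_sub_eq hab, ← mCdf_sub_eq hab] at h'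
  simp only [Δ, Fl, Fh]
  linarith

lemma Δ_antitoneOn (hm : D.vlo < m ∧ (m : EReal) < D.vhi) (heq : D.fl m = D.fh m) :
    AntitoneOn D.Δ (Ici m) := by
  intro a ha b _ hab
  have h : D.μl (Ioc a b) ≤ D.μh (Ioc a b) := by
    rw [D.dens_l, D.dens_h]
    exact withDensity_mono_on measurableSet_Ioc fun v hv =>
      fl_le_fh hm heq (le_trans ha hv.1.le)
  have h' : D.μl.real (Ioc a b) ≤ D.μh.real (Ioc a b) :=
    ENNReal.toReal_mono (measure_ne_top _ _) h
  rw [← mCdf_sub_eq hab, ← mCdf_sub_eq hab] at h'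
  simp only [Δ, Fl, Fh]
  linarith

lemma Δ_nonneg_of_ge (hm : D.vlo < m ∧ (m : EReal) < D.vhi) (heq : D.fl m = D.fh m)
    {v : ℝ} (hv : m ≤ v) : 0 ≤ D.Δ v := by
  have h : D.μl (Ioi v) ≤ D.μh (Ioi v) := by
    rw [D.dens_l, D.dens_h]
    exact withDensity_mono_on measurableSet_Ioi fun w hw =>
      fl_le_fh hm heq (hv.trans (le_of_lt hw))
  have h' : D.μl.real (Ioi v) ≤ D.μh.real (Ioi v) :=
    ENNReal.toReal_mono (measure_ne_top _ _) h
  simp only [Δ, Fl, Fh, mCdf_eq_one_sub]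
  linarith

end Crossing

end MarketData

section Slackness

variable {c α k1 k2 k3 k4 k5 vl vh : ℝ}

lemma continuous_phiStar (h34 : k3 ≤ k4) (h45 : k4 ≤ k5) (e1 : k1 - c = (1 - α) * (k3 - c))
    (e2 : k1 - c = α * (k5 - k4)) : Continuous (phiStar c α k1 k3 k4 k5) := by
  unfold phiStar
  refine Continuous.if_le (by fun_prop) ?_ continuous_id continuous_const ?_
  · refine Continuous.if_le (by fun_prop) ?_ continuous_id continuous_const ?_
    · refine Continuous.if_le (by fun_prop) (by fun_prop) continuous_id continuous_const ?_
      rintro x rfl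
      linarith
    · rintro x rfl
      rw [if_pos h45]
      ring
  · rintro x rfl
    rw [if_pos h34, e1]

lemma continuous_psiStar (h13 : k1 ≤ k3) (h34 : k3 ≤ k4) (h45 : k4 ≤ k5)
    (e1 : k1 - c = (1 - α) * (k3 - c)) (e2 : k1 - c = α * (k5 - k4)) :
    Continuous (psiStar c α k1 k3 k4 k5) := by
  unfold psiStar
  refine Continuous.if_le (by fun_prop) ?_ continuous_id continuous_const ?_
  · refine Continuous.if_le (by fun_prop) ?_ continuous_id continuous_const ?_
    · refine Continuous.if_le (by fun_prop) ?_ continuous_id continuous_const ?_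
      · refine Continuous.if_le (by fun_prop) (by fun_prop) continuous_id continuous_const ?_
        rintro x rfl
        linarith
      · rintro x rfl
        rw [if_pos h45]
    · rintro x rfl
      rw [if_pos h34]
      linarith
  · rintro x rfl
    rw [if_pos h13, sub_self]

lemma continuous_pairProfit : Continuous fun p : ℝ × ℝ => pairProfit c α p.1 p.2 := by
  unfold pairProfit
  fun_prop

lemma pairProfit_eq_min (hmin : 0 ≤ min vl vh - c)
    (hh : α * (vh - c) ≤ min vl vh - c) (hl : (1 - α) * (vl - c) ≤ min vl vh - c) :
    pairProfit c α vl vh = min vl vh - c := by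
  have h1 : c ≤ vl := by linarith [min_le_left vl vh]
  have h2 : c ≤ vh := by linarith [min_le_right vl vh]
  rw [pairProfit, max_eq_left (sub_nonneg.mpr h1), max_eq_left (sub_nonneg.mpr h2)]
  exact max_eq_left (max_le hh hl)

lemma slack_on_lowest (hα : α ∈ Ioo (0 : ℝ) 1) (hc1 : c < k1)
    (e1 : k1 - c = (1 - α) * (k3 - c)) (hh : vh ≤ k1) (hl3 : k3 ≤ vl) (hl4 : vl ≤ k4) :
    phiStar c α k1 k3 k4 k5 vl + psiStar c α k1 k3 k4 k5 vh = pairProfit c α vl vh := by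
  obtain ⟨hα0, hα1⟩ := hα
  have hφ : phiStar c α k1 k3 k4 k5 vl = (1 - α) * (vl - c) := by
    unfold phiStar
    split_ifs with h
    · rw [e1, le_antisymm h hl3]
    · rfl
  have hl : k1 - c ≤ (1 - α) * (vl - c) := by nlinarith
  have hvl : c ≤ vl := by nlinarith
  rw [hφ, psiStar, if_pos hh, add_zero, pairProfit, max_eq_left (sub_nonneg.mpr hvl),
    max_eq_right, max_eq_right]
  · rw [mul_max_of_nonneg _ _ hα0.le]
    refine max_le ?_ (by linarith)
    nlinarith
  · exact le_max_of_le_right (by linarith [min_le_right vl vh])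

lemma slack_on_low (hα : α ∈ Ioo (0 : ℝ) 1) (hc1 : c < k1)
    (e1 : k1 - c = (1 - α) * (k3 - c)) (hh1 : k1 < vh) (hh3 : vh ≤ k3) (hlh : vh ≤ vl)
    (hl3 : vl ≤ k3) :
    phiStar c α k1 k3 k4 k5 vl + psiStar c α k1 k3 k4 k5 vh = pairProfit c α vl vh := by
  obtain ⟨hα0, hα1⟩ := hα
  rw [phiStar, if_pos hl3, psiStar, if_neg hh1.not_ge, if_pos hh3,
    pairProfit_eq_min] <;> rw [min_eq_right hlh] <;> nlinarith

lemma slack_on_diagonal (hα : α ∈ Ioo (0 : ℝ) 1) (hc3 : c < k3) (h13 : k1 ≤ k3)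
    (hv3 : k3 < vl) (hv4 : vl ≤ k4) :
    phiStar c α k1 k3 k4 k5 vl + psiStar c α k1 k3 k4 k5 vl = pairProfit c α vl vl := by
  obtain ⟨hα0, hα1⟩ := hα
  rw [phiStar, if_neg hv3.not_ge, if_pos hv4, psiStar, if_neg (h13.trans_lt hv3).not_ge,
    if_neg hv3.not_ge, if_pos hv4, pairProfit_eq_min] <;> rw [min_self] <;> nlinarith

lemma slack_on_middle (hα : α ∈ Ioo (0 : ℝ) 1) (hc1 : c < k1) (h13 : k1 ≤ k3) (h34 : k3 ≤ k4)
    (e1 : k1 - c = (1 - α) * (k3 - c)) (e2 : k1 - c = α * (k5 - k4))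
    (hh4 : k4 < vh) (hh5 : vh ≤ k5) (hl4 : k4 < vl) (hlh : vl ≤ vh) :
    phiStar c α k1 k3 k4 k5 vl + psiStar c α k1 k3 k4 k5 vh = pairProfit c α vl vh := by
  obtain ⟨hα0, hα1⟩ := hα
  rw [phiStar, if_neg (h34.trans_lt hl4).not_ge, if_neg hl4.not_ge, if_pos (hlh.trans hh5),
    psiStar, if_neg (by linarith), if_neg (by linarith), if_neg hh4.not_ge, if_pos hh5,
    pairProfit_eq_min] <;> rw [min_eq_left hlh]
  · ring
  · linarith
  · nlinarith
  · nlinarith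

lemma slack_on_high_diagonal (hα : α ∈ Ioo (0 : ℝ) 1) (hc1 : c < k1) (h13 : k1 ≤ k3)
    (h34 : k3 ≤ k4) (h45 : k4 ≤ k5) (hv : k5 < vl) :
    phiStar c α k1 k3 k4 k5 vl + psiStar c α k1 k3 k4 k5 vl = pairProfit c α vl vl := by
  obtain ⟨hα0, hα1⟩ := hα
  rw [phiStar, if_neg (by linarith), if_neg (by linarith), if_neg (by linarith),
    psiStar, if_neg (by linarith), if_neg (by linarith), if_neg (by linarith),
    if_neg (by linarith), pairProfit_eq_min] <;> rw [min_self] <;> nlinarith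

lemma slack_on_high (hα : α ∈ Ioo (0 : ℝ) 1) (hc1 : c < k1) (h13 : k1 ≤ k3) (h34 : k3 ≤ k4)
    (h45 : k4 ≤ k5) (e1 : k1 - c = (1 - α) * (k3 - c)) (e2 : k1 - c = α * (k5 - k4))
    (hh : k5 < vh) (hl : vl ≤ k3) :
    phiStar c α k1 k3 k4 k5 vl + psiStar c α k1 k3 k4 k5 vh = pairProfit c α vl vh := by
  obtain ⟨hα0, hα1⟩ := hα
  rw [phiStar, if_pos hl, psiStar, if_neg (by linarith), if_neg (by linarith),
    if_neg (by linarith), if_neg (by linarith), pairProfit,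
    max_eq_left (sub_nonneg.mpr (by linarith : c ≤ vh)), max_eq_left (a := α * (vh - c)),
    max_eq_right]
  · ring
  · nlinarith [min_le_left vl vh]
  · rw [mul_max_of_nonneg _ _ (by linarith)]
    refine max_le ?_ ?_ <;> nlinarith

end Slackness

/-- The kernel `γ⋆` charges no set that avoids the tight pairs. -/
lemma gammaStar_eq_zero (D : MarketData) {c α : ℝ} (hc : 0 ≤ c) (hα : α ∈ Ioo (0 : ℝ) 1)
    {vstar : ℝ} (hv : IsVStar D vstar) {κ : Kappa} (hκ : KappaSystem D.Fl D.Fh c α κ)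
    (h4s : κ.k4 < vstar) (hs5 : vstar < κ.k5) {vh : ℝ}
    (hvh : D.vlo < vh ∧ (vh : EReal) < D.vhi) {A : Set ℝ}
    (hA : ∀ vl ∈ A, phiStar c α κ.k1 κ.k3 κ.k4 κ.k5 vl + psiStar c α κ.k1 κ.k3 κ.k4 κ.k5 vh ≠
      pairProfit c α vl vh) (hAm : MeasurableSet A) : gammaStar D κ vh A = 0 := by
  obtain ⟨h12, h23, h34, h45, e2a, e2b, e2c, e1, e2⟩ := hκ
  have h13 := h12.trans h23
  have hc1 : c < κ.k1 := by nlinarith [mul_pos hα.1 (sub_pos.mpr (h4s.trans hs5))]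
  have hk2 : 0 < κ.k2 := by linarith
  have key : ∀ q, κ.k2 = invCdf D.Fl q → 0 < q ∧ D.Fl κ.k2 = q := by
    rintro q hq
    rw [hq]
    exact apply_invCdf_of_pos D.Fl_mono D.continuous_Fl (fun v => mCdf_nonneg v)
      (D.Fl_eq_zero le_rfl) (hq ▸ hk2)
  obtain ⟨-, ha⟩ := key _ e2a
  obtain ⟨hb0, hb⟩ := key _ e2b
  obtain ⟨-, hc'⟩ := key _ e2c
  change D.Fl κ.k2 = D.Δ κ.k3 + D.Fh κ.k1 at ha
  change 0 < D.Δ κ.k4 at hb0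
  change D.Fl κ.k2 = D.Δ κ.k4 at hb
  change D.Fl κ.k2 = D.Δ κ.k5 at hc'
  have hm := D.mem_interval_of_Δ_pos (hb0.trans_le (hv.2.1 κ.k4))
  have hmono := MarketData.Δ_monotoneOn hm hv.1
  have hanti := MarketData.Δ_antitoneOn hm hv.1
  have dirac_zero : ∀ w, phiStar c α κ.k1 κ.k3 κ.k4 κ.k5 w +
      psiStar c α κ.k1 κ.k3 κ.k4 κ.k5 vh = pairProfit c α w vh → Measure.dirac w A = 0 := by
    intro w hw
    rw [Measure.dirac_apply' _ hAm, indicator_of_notMem fun h => hA w h hw]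
  have hΔ : ∀ v, D.Fl v = D.Fh v + D.Δ v := fun v => by simp [MarketData.Δ]
  have hFh0 : 0 < D.Fh vh := (mCdf_nonneg D.vlo).trans_lt (D.Fh_lt hvh.1 hvh)
  unfold gammaStar
  split_ifs with h1 h3 h4 h5
  · have hmem : D.Fh vh + D.Δ κ.k3 ≤ D.Δ κ.k4 := by linarith [D.Fh_mono h1]
    have hlb : ∀ v ∈ {v | D.Fh vh + D.Δ κ.k3 ≤ D.Δ v}, κ.k3 ≤ v := by
      intro v hv'
      rw [mem_ofPred_eq] at hv'
      by_contra! hlt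
      have := hmono (show v ≤ vstar by linarith) (show κ.k3 ≤ vstar by linarith) hlt.le
      linarith
    exact dirac_zero _ (slack_on_lowest hα hc1 e1 h1 (le_csInf ⟨_, hmem⟩ hlb)
      (csInf_le ⟨_, hlb⟩ hmem))
  · have hmem : D.Fh vh + D.Δ κ.k3 ≤ D.Fl κ.k3 := by linarith [D.Fh_mono h3, hΔ κ.k3]
    have hlb : ∀ v ∈ {v | D.Fh vh + D.Δ κ.k3 ≤ D.Fl v}, vh ≤ v := by
      intro v hv'
      rw [mem_ofPred_eq] at hv'
      by_contra! hlt
      have := hmono (show vh ≤ vstar by linarith) (show κ.k3 ≤ vstar by linarith) h3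
      linarith [D.Fl_lt hlt hvh, hΔ vh]
    exact dirac_zero _ (slack_on_low hα hc1 e1 (not_le.mp h1) h3 (le_csInf ⟨_, hmem⟩ hlb)
      (csInf_le ⟨_, hlb⟩ hmem))
  · exact dirac_zero _ (slack_on_diagonal hα (by linarith) h13 (not_le.mp h3) h4)
  · have hΔle : D.Δ κ.k4 ≤ D.Δ vh := by
      rcases le_total vh vstar with hle | hge
      · exact hmono h4s.le hle (not_le.mp h4).le
      · linarith [hanti hge hs5.le h5]
    have hmem : D.Fh vh + D.Δ κ.k4 ≤ D.Fl vh := by linarith [hΔ vh]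
    have hgt : D.Fl κ.k4 < D.Fh vh + D.Δ κ.k4 := by
      linarith [hΔ κ.k4, D.Fh_lt (not_le.mp h4) hvh]
    have hval := apply_invCdf D.Fl_mono D.continuous_Fl hgt ⟨_, hmem⟩
    exact dirac_zero _ (slack_on_middle hα hc1 h13 h34 e1 e2 (not_le.mp h4) h5
      (D.Fl_mono.reflect_lt (hgt.trans_eq hval.symm))
      (csInf_le (bddBelow_superlevel D.Fl_mono hgt) hmem))
  · have h5' := not_le.mp h5
    have hle : invCdf D.Fl (D.Δ κ.k5 - D.Δ vh) ≤ κ.k3 := by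
      refine le_trans ?_ h23
      have hΔ0 := MarketData.Δ_nonneg_of_ge hm hv.1 (hs5.trans h5').le
      rcases le_or_gt (D.Δ κ.k5 - D.Δ vh) 0 with hq | hq
      · have : {v | D.Δ κ.k5 - D.Δ vh ≤ D.Fl v} = univ :=
          eq_univ_of_forall fun v => hq.trans (mCdf_nonneg v)
        rw [invCdf, this, Real.sInf_univ]
        exact hk2.le
      · exact csInf_le (bddBelow_superlevel D.Fl_mono ((D.Fl_eq_zero le_rfl).trans_lt hq))
          (show D.Δ κ.k5 - D.Δ vh ≤ D.Fl κ.k2 by linarith)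
    have z1 := dirac_zero _ (slack_on_high_diagonal hα hc1 h13 h34 h45 h5')
    have z2 := dirac_zero _ (slack_on_high hα hc1 h13 h34 h45 e1 e2 h5' hle)
    simp [z1, z2]

/-- complementary slackness: on the support of the coupling `ρ⋆`
the dual pair `(φ⋆, ψ⋆)` is tight, `φ⋆(v_l) + ψ⋆(v_h) = π(v_l, v_h)`. -/
theorem stmt3 (D : MarketData) (c α : ℝ) (hc : 0 ≤ c) (hα : α ∈ Ioo (0 : ℝ) 1)
    (vstar : ℝ) (hv : IsVStar D vstar)
    (hns : D.Fl c < tvDist D.μl D.μh)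
    (κ : Kappa) (hκ : KappaSystem D.Fl D.Fh c α κ ∧ κ.k4 < vstar ∧ vstar < κ.k5)
    (ρstar : Measure (ℝ × ℝ)) (hρprob : IsProbabilityMeasure ρstar)
    (hρdef : ∀ A B : Set ℝ, MeasurableSet A → MeasurableSet B →
      ρstar (A ×ˢ B) = ∫⁻ vh in B, gammaStar D κ vh A ∂D.μh) :
    ∀ p : ℝ × ℝ, p ∈ measSupport ρstar →
      phiStar c α κ.k1 κ.k3 κ.k4 κ.k5 p.1 + psiStar c α κ.k1 κ.k3 κ.k4 κ.k5 p.2 =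
        pairProfit c α p.1 p.2 := by
  obtain ⟨hκs, h4s, hs5⟩ := hκ
  have hsys := hκs
  obtain ⟨h12, h23, h34, h45, -, -, -, e1, e2⟩ := hsys
  intro p hp
  by_contra hne
  have hopen : IsOpen {p : ℝ × ℝ | phiStar c α κ.k1 κ.k3 κ.k4 κ.k5 p.1 +
      psiStar c α κ.k1 κ.k3 κ.k4 κ.k5 p.2 ≠ pairProfit c α p.1 p.2} :=
    isOpen_ne_fun
      (((continuous_phiStar h34 h45 e1 e2).comp continuous_fst).add
        ((continuous_psiStar (h12.trans h23) h34 h45 e1 e2).comp continuous_snd))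
      continuous_pairProfit
  obtain ⟨A, B, hA, hB, hpA, hpB, hAB⟩ := isOpen_prod_iff.mp hopen p.1 p.2 hne
  refine (hp (A ×ˢ B) (hA.prod hB) ⟨hpA, hpB⟩).ne' ?_
  rw [hρdef A B hA.measurableSet hB.measurableSet,
    setLIntegral_congr_fun_ae hB.measurableSet (g := fun _ => 0), lintegral_zero]
  filter_upwards [D.ae_mem_interval] with vh hvh hvB
  exact gammaStar_eq_zero D hc hα hv hκs h4s hs5 hvh
    (fun vl hvl => hAB (mk_mem_prod hvl hvB)) hA.measurableSet
end
end

section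
/- Assume ∫ v dμ_h(v) < ∞. For every coupling ρ of (F_l, F_h), there exists a non-discriminatory pricing rule (p_l, p_h) taking values in [0, ∞) whose profit equals the matched-pair value: Π(p) = ∫ π dρ. -/
open MeasureTheory Set Filter

noncomputable section

/-- The uniform (Lebesgue) probability measure on `[0,1]`. -/
def unif : Measure ℝ := volume.restrict (Icc (0 : ℝ) 1)

/-- A pricing rule `(p_l, p_h)` is non-discriminatory if the price distribution
faced by `l`-consumers equals the price distribution faced by `h`-consumers. -/
def NonDiscriminatory (μl μh : Measure ℝ) (pl ph : ℝ × ℝ → ℝ) : Prop :=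
  (μl.prod unif).map pl = (μh.prod unif).map ph

/-- The seller's profit from the pricing rule `(p_l, p_h)`. -/
def profit (μl μh : Measure ℝ) (c α : ℝ) (pl ph : ℝ × ℝ → ℝ) : ℝ :=
  (1 - α) * ∫ x, (if pl x ≤ x.1 then pl x - c else 0) ∂(μl.prod unif) +
    α * ∫ x, (if ph x ≤ x.1 then ph x - c else 0) ∂(μh.prod unif)

/-- A probability measure on the plane is the law of `(x, k (x, r))`, where `x` has the law of its
first marginal and `r` is independent and uniform. -/
lemma exists_measurable_map_prod_unif_eq (ρ : Measure (ℝ × ℝ)) [IsProbabilityMeasure ρ] :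
    ∃ k : ℝ × ℝ → ℝ, Measurable k ∧ (ρ.fst.prod unif).map (fun x => (x.1, k x)) = ρ := by
  obtain ⟨f, hf, hfκ⟩ :=
    ProbabilityTheory.Kernel.exists_measurable_map_eq_unitInterval ρ.condKernel
  have hk : Measurable fun x : ℝ × ℝ => f x.1 (projIcc 0 1 (zero_le_one' ℝ) x.2) :=
    hf.comp (measurable_fst.prodMk
      ((continuous_projIcc (h := zero_le_one' ℝ)).measurable.comp measurable_snd))
  have : SFinite unif := by unfold unif; infer_instance
  refine ⟨_, hk, Measure.ext_of_lintegral _ fun g hg => ?_⟩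
  have hgk : Measurable fun x : ℝ × ℝ => g (x.1, f x.1 (projIcc 0 1 (zero_le_one' ℝ) x.2)) :=
    hg.comp (measurable_fst.prodMk hk)
  conv_rhs => rw [← ρ.disintegrate ρ.condKernel]
  rw [lintegral_map hg (measurable_fst.prodMk hk), lintegral_prod _ hgk.aemeasurable,
    Measure.lintegral_compProd hg]
  refine lintegral_congr fun a => ?_
  have hga : Measurable fun r : ℝ => g (a, f a (projIcc 0 1 (zero_le_one' ℝ) r)) :=
    hgk.comp measurable_prodMk_left
  dsimp only
  rw [unif, ← unitInterval.measurePreserving_coe.map_eq,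
    lintegral_map hga measurable_subtype_coe, ← hfκ a,
    lintegral_map (f := fun b => g (a, b)) (hg.comp measurable_prodMk_left) hf.of_uncurry_left]
  simp

/-- The mirror image of `exists_measurable_map_prod_unif_eq`, for the second marginal. -/
lemma exists_measurable_map_prod_unif_eq' (ρ : Measure (ℝ × ℝ)) [IsProbabilityMeasure ρ] :
    ∃ k : ℝ × ℝ → ℝ, Measurable k ∧ (ρ.snd.prod unif).map (fun x => (k x, x.1)) = ρ := by
  have := Measure.isProbabilityMeasure_map (μ := ρ) measurable_swap.aemeasurable
  obtain ⟨k, hk, hkρ⟩ := exists_measurable_map_prod_unif_eq (ρ.map Prod.swap)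
  rw [Measure.fst_map_swap] at hkρ
  refine ⟨k, hk, ?_⟩
  have h := congrArg (Measure.map Prod.swap) hkρ
  rw [Measure.map_map measurable_swap (measurable_fst.prodMk hk),
    Measure.map_map measurable_swap measurable_swap, Prod.swap_swap_eq, Measure.map_id] at h
  exact h

/-- A price which, offered to both members of the pair `(a, b)`, earns `pairProfit c α a b`. -/
def pairPrice (c α a b : ℝ) : ℝ :=
  if max (α * max (b - c) 0) ((1 - α) * max (a - c) 0) ≤ min a b - c then min a b
  else if (1 - α) * max (a - c) 0 ≤ α * max (b - c) 0 then max b c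
  else max a c

lemma measurable_pairPrice (c α : ℝ) :
    Measurable fun p : ℝ × ℝ => pairPrice c α p.1 p.2 := by
  unfold pairPrice
  refine Measurable.ite (measurableSet_le (by fun_prop) (by fun_prop)) (by fun_prop)
    (Measurable.ite (measurableSet_le (by fun_prop) (by fun_prop)) (by fun_prop) (by fun_prop))

lemma le_pairPrice {c α : ℝ} (hα : 0 ≤ α) (a b : ℝ) : c ≤ pairPrice c α a b := by
  unfold pairPrice
  split_ifs with h
  · have h₁ : 0 ≤ α * max (b - c) 0 := mul_nonneg hα (le_max_right _ _)
    linarith [(le_max_left _ _).trans h]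
  · exact le_max_right _ _
  · exact le_max_right _ _

/-- Revenue net of cost from offering the price `p` to a consumer of value `v`. -/
def saleProfit (c p v : ℝ) : ℝ := if p ≤ v then p - c else 0

lemma measurable_saleProfit (c : ℝ) : Measurable fun x : ℝ × ℝ => saleProfit c x.1 x.2 :=
  Measurable.ite (measurableSet_le measurable_fst measurable_snd) (by fun_prop) measurable_const

lemma saleProfit_max_self {c v : ℝ} : saleProfit c (max v c) v = max (v - c) 0 := by
  unfold saleProfit
  rcases le_total v c with h | h
  · simp [h]
  · simp [h]

lemma abs_saleProfit_le {c p : ℝ} (hc : 0 ≤ c) (hp : c ≤ p) (v : ℝ) :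
    |saleProfit c p v| ≤ |v| := by
  unfold saleProfit
  split_ifs with h
  · rw [abs_of_nonneg (by linarith)]
    linarith [le_abs_self v]
  · simp

lemma saleProfit_pairPrice {c α : ℝ} (hα : α ∈ Ioo (0 : ℝ) 1) (a b : ℝ) :
    (1 - α) * saleProfit c (pairPrice c α a b) a + α * saleProfit c (pairPrice c α a b) b =
      pairProfit c α a b := by
  obtain ⟨h0, h1⟩ := hα
  have h1' : 0 < 1 - α := by linarith
  unfold pairPrice pairProfit
  split_ifs with h h'
  · rw [max_eq_left h, saleProfit, saleProfit, if_pos (min_le_left _ _),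
      if_pos (min_le_right _ _)]
    ring
  · push Not at h
    rw [max_eq_right h.le, max_eq_left h', saleProfit_max_self]
    rw [max_eq_left h'] at h
    suffices saleProfit c (max b c) a = 0 by rw [this]; ring
    rcases le_total b c with hb | hb
    · simp [saleProfit, hb]
    · rw [max_eq_left (by linarith : 0 ≤ b - c)] at h
      rw [max_eq_left hb, saleProfit, if_neg]
      intro hab
      rw [min_eq_right hab] at h
      nlinarith
  · push Not at h h'
    rw [max_eq_right h.le, max_eq_right h'.le, saleProfit_max_self]
    rw [max_eq_right h'.le] at h
    suffices saleProfit c (max a c) b = 0 by rw [this]; ring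
    rcases le_total a c with ha | ha
    · simp [saleProfit, ha]
    · rw [max_eq_left (by linarith : 0 ≤ a - c)] at h
      rw [max_eq_left ha, saleProfit, if_neg]
      intro hab
      rw [min_eq_left hab] at h
      nlinarith

lemma integrable_withDensity_ofReal_iff {f g : ℝ → ℝ} (hf : Measurable f) (hf0 : ∀ v, 0 ≤ f v) :
    Integrable g (volume.withDensity fun v => ENNReal.ofReal (f v)) ↔
      Integrable fun v => f v * g v := by
  rw [integrable_withDensity_iff_integrable_smul' hf.ennreal_ofReal (by simp)]
  simp only [ENNReal.toReal_ofReal (hf0 _), smul_eq_mul]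

/-- Beyond any point of the support, `f_l` is at most a multiple of `f_h`. -/
lemma MarketData.exists_fl_le (D : MarketData) :
    ∃ v₀ C : ℝ, 0 ≤ C ∧ ∀ v, v₀ < v → D.fl v ≤ C * D.fh v := by
  obtain ⟨v₀, hlo, hhi⟩ := EReal.lt_iff_exists_real_btwn.1 D.vlo_lt_vhi
  have hlo' : D.vlo < v₀ := EReal.coe_lt_coe_iff.1 hlo
  have hl := (D.fl_pos_iff v₀).2 ⟨hlo', hhi⟩
  have hh := (D.fh_pos_iff v₀).2 ⟨hlo', hhi⟩
  refine ⟨v₀, D.fl v₀ / D.fh v₀, by positivity, fun v hv => ?_⟩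
  rcases (D.fl_nonneg v).eq_or_lt with h | h
  · rw [← h]
    exact mul_nonneg (by positivity) (D.fh_nonneg v)
  · have hlt := D.lr_strictMono (a := v₀) (b := v) ⟨hlo', hhi⟩ ((D.fl_pos_iff v).1 h) hv
    simp only at hlt
    rw [div_lt_div_iff₀ hl h] at hlt
    rw [div_mul_eq_mul_div, le_div_iff₀ hh]
    linarith

lemma MarketData.integrable_id_μl (D : MarketData)
    (hmom : Integrable (fun v : ℝ => v) D.μh) : Integrable (fun v : ℝ => v) D.μl := by
  obtain ⟨v₀, C, hC, hle⟩ := D.exists_fl_le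
  have := D.probl
  have hone : Integrable (fun _ : ℝ => (1 : ℝ)) D.μl := integrable_const 1
  rw [D.dens_l, integrable_withDensity_ofReal_iff D.meas_fl D.fl_nonneg] at hone ⊢
  rw [D.dens_h, integrable_withDensity_ofReal_iff D.meas_fh D.fh_nonneg] at hmom
  refine ((hone.const_mul |v₀|).add (hmom.const_mul C)).mono'
    (D.meas_fl.mul measurable_id).aestronglyMeasurable (ae_of_all _ fun v => ?_)
  simp only [Pi.add_apply, mul_one, Real.norm_eq_abs, abs_mul, abs_of_nonneg (D.fl_nonneg v)]
  have hl := D.fl_nonneg v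
  have hh := D.fh_nonneg v
  rcases hl.eq_or_lt with h | h
  · have hv : D.fh v = 0 :=
      le_antisymm (not_lt.1 fun hh' =>
        (((D.fl_pos_iff v).2 ((D.fh_pos_iff v).1 hh')).ne h)) hh
    simp [← h, hv]
  · have hv : 0 < v := D.vlo_nonneg.trans_lt ((D.fl_pos_iff v).1 h).1
    rw [abs_of_pos hv]
    rcases le_or_gt v v₀ with hvv | hvv
    · have h₁ : D.fl v * v ≤ D.fl v * |v₀| :=
        mul_le_mul_of_nonneg_left (hvv.trans (le_abs_self _)) hl
      have h₂ : 0 ≤ C * (D.fh v * v) := by positivity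
      linarith
    · have h₁ : D.fl v * v ≤ C * D.fh v * v := mul_le_mul_of_nonneg_right (hle v hvv) hv.le
      have h₂ : 0 ≤ |v₀| * D.fl v := by positivity
      linarith

/-- every coupling of `(F_l, F_h)` can be implemented: there is a
non-discriminatory pricing rule with values in `[0, ∞)` whose profit equals the
matched-pair value `∫ π dρ`. -/
theorem stmt7 (D : MarketData) (c α : ℝ) (hc : 0 ≤ c) (hα : α ∈ Ioo (0 : ℝ) 1)
    (hmom : Integrable (fun v : ℝ => v) D.μh)
    (ρ : Measure (ℝ × ℝ)) (hρ : IsCoupling D.μl D.μh ρ) :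
    ∃ pl ph : ℝ × ℝ → ℝ, Measurable pl ∧ Measurable ph ∧
      (∀ x, 0 ≤ pl x) ∧ (∀ x, 0 ≤ ph x) ∧
      NonDiscriminatory D.μl D.μh pl ph ∧
      profit D.μl D.μh c α pl ph = ∫ p, pairProfit c α p.1 p.2 ∂ρ := by
  have hl := D.probl
  have hh := D.probh
  have hmoml := D.integrable_id_μl hmom
  obtain ⟨hρl, hρh⟩ := hρ
  rw [← hρl] at hl hmoml
  rw [← hρh] at hmom
  have hprob : IsProbabilityMeasure ρ := ⟨by rw [← Measure.fst_univ]; exact hl.measure_univ⟩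
  have hP := measurable_pairPrice c α
  have hcP (p : ℝ × ℝ) : c ≤ pairPrice c α p.1 p.2 := le_pairPrice hα.1.le p.1 p.2
  have hsl : Measurable fun p : ℝ × ℝ => saleProfit c (pairPrice c α p.1 p.2) p.1 :=
    (measurable_saleProfit c).comp (hP.prodMk measurable_fst)
  have hsh : Measurable fun p : ℝ × ℝ => saleProfit c (pairPrice c α p.1 p.2) p.2 :=
    (measurable_saleProfit c).comp (hP.prodMk measurable_snd)
  have hil : Integrable (fun p : ℝ × ℝ => saleProfit c (pairPrice c α p.1 p.2) p.1) ρ :=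
    (hmoml.comp_measurable measurable_fst).abs.mono' hsl.aestronglyMeasurable
      (ae_of_all _ fun p => abs_saleProfit_le hc (hcP p) _)
  have hih : Integrable (fun p : ℝ × ℝ => saleProfit c (pairPrice c α p.1 p.2) p.2) ρ :=
    (hmom.comp_measurable measurable_snd).abs.mono' hsh.aestronglyMeasurable
      (ae_of_all _ fun p => abs_saleProfit_le hc (hcP p) _)
  obtain ⟨kl, hkl, hklρ⟩ := exists_measurable_map_prod_unif_eq ρ
  obtain ⟨kh, hkh, hkhρ⟩ := exists_measurable_map_prod_unif_eq' ρ
  rw [hρl] at hklρ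
  rw [hρh] at hkhρ
  have hml : Measurable fun x : ℝ × ℝ => (x.1, kl x) := measurable_fst.prodMk hkl
  have hmh : Measurable fun x : ℝ × ℝ => (kh x, x.1) := hkh.prodMk measurable_fst
  refine ⟨fun x => pairPrice c α x.1 (kl x), fun x => pairPrice c α (kh x) x.1,
    hP.comp hml, hP.comp hmh, fun x => hc.trans (hcP (x.1, kl x)),
    fun x => hc.trans (hcP (kh x, x.1)), ?_, ?_⟩
  · have h₁ := Measure.map_map (μ := D.μl.prod unif) hP hml
    have h₂ := Measure.map_map (μ := D.μh.prod unif) hP hmh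
    rw [hklρ] at h₁
    rw [hkhρ] at h₂
    exact h₁.symm.trans h₂
  · have h₁ := integral_map (μ := D.μl.prod unif) hml.aemeasurable hsl.aestronglyMeasurable
    have h₂ := integral_map (μ := D.μh.prod unif) hmh.aemeasurable hsh.aestronglyMeasurable
    rw [hklρ] at h₁
    rw [hkhρ] at h₂
    simp only [← saleProfit_pairPrice hα]
    rw [integral_add (hil.const_mul _) (hih.const_mul _), integral_const_mul, integral_const_mul,
      h₁, h₂]
    rfl
end
end

section
/- Assume ∫ v dμ_h(v) < ∞. Then the seller can fully extract all gains from trade via matched pairs, i.e. sup over all couplings ρ of (F_l, F_h) of ∫ π dρ equals (1−α)·∫ max(v − c, 0) dμ_l(v) + α·∫ max(v − c, 0) dμ_h(v), if and only if F_l(c) ≥ ‖F_l − F_h‖. -/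
open MeasureTheory Set Filter

noncomputable section

/-- The total gains from trade available in a matched pair. -/
def pairSurplus (c α vl vh : ℝ) : ℝ :=
  (1 - α) * max (vl - c) 0 + α * max (vh - c) 0

theorem pairProfit_nonneg {c α : ℝ} (hα : α ∈ Ioo (0 : ℝ) 1) (x y : ℝ) :
    0 ≤ pairProfit c α x y :=
  le_max_of_le_right (le_max_of_le_left (mul_nonneg hα.1.le (le_max_right _ _)))

theorem pairProfit_le_pairSurplus {c α : ℝ} (hα : α ∈ Ioo (0 : ℝ) 1) (x y : ℝ) :
    pairProfit c α x y ≤ pairSurplus c α x y := by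
  obtain ⟨h0, h1⟩ := hα
  have hx := le_max_left (x - c) 0
  have hx' := le_max_right (x - c) 0
  have hy := le_max_left (y - c) 0
  have hy' := le_max_right (y - c) 0
  unfold pairProfit pairSurplus
  refine max_le ?_ (max_le ?_ ?_)
  · have := min_le_left x y
    have := min_le_right x y
    nlinarith
  · nlinarith
  · nlinarith

theorem pairProfit_eq_pairSurplus {c α : ℝ} (hα : α ∈ Ioo (0 : ℝ) 1) {x y : ℝ}
    (h : x = y ∨ x ≤ c ∨ y ≤ c) : pairProfit c α x y = pairSurplus c α x y := by
  refine (pairProfit_le_pairSurplus hα x y).antisymm ?_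
  unfold pairProfit pairSurplus
  rcases h with rfl | h | h
  · rcases le_total x c with h | h
    · rw [max_eq_right (sub_nonpos.2 h)]
      simp
    · rw [max_eq_left (sub_nonneg.2 h)]
      refine le_max_of_le_left ?_
      rw [min_self]
      linarith
  · rw [max_eq_right (sub_nonpos.2 h)]
    simp
  · rw [max_eq_right (sub_nonpos.2 h)]
    simp

theorem pairProfit_add_le_pairSurplus {c α a b p x y : ℝ} (hα : α ∈ Ioo (0 : ℝ) 1)
    (hca : c < a) (hx : x ∈ Icc a b) (hbp : b < p) (hy : p < y) :
    pairProfit c α x y + min (α * (p - b)) ((1 - α) * (a - c)) ≤ pairSurplus c α x y := by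
  obtain ⟨h0, h1⟩ := hα
  obtain ⟨hx1, hx2⟩ := hx
  have e1 := min_le_left (α * (p - b)) ((1 - α) * (a - c))
  have e2 := min_le_right (α * (p - b)) ((1 - α) * (a - c))
  rw [← le_sub_iff_add_le]
  unfold pairProfit pairSurplus
  rw [max_eq_left (by linarith : 0 ≤ x - c), max_eq_left (by linarith : 0 ≤ y - c),
    min_eq_left (by linarith : x ≤ y)]
  refine max_le ?_ (max_le ?_ ?_) <;> nlinarith

theorem measurable_pairProfit (c α : ℝ) :
    Measurable fun p : ℝ × ℝ => pairProfit c α p.1 p.2 := by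
  unfold pairProfit
  fun_prop

theorem IsCoupling.isProbabilityMeasure {μ ν : Measure ℝ} {ρ : Measure (ℝ × ℝ)}
    [IsProbabilityMeasure μ] (h : IsCoupling μ ν ρ) : IsProbabilityMeasure ρ :=
  ⟨by rw [← Measure.fst_univ, h.1, measure_univ]⟩

theorem IsCoupling.integrable_pairSurplus {μ ν : Measure ℝ} {ρ : Measure (ℝ × ℝ)}
    (h : IsCoupling μ ν ρ) {c : ℝ} (α : ℝ) (hμ : Integrable (fun v => max (v - c) 0) μ)
    (hν : Integrable (fun v => max (v - c) 0) ν) :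
    Integrable (fun p : ℝ × ℝ => pairSurplus c α p.1 p.2) ρ := by
  rw [← h.1] at hμ
  rw [← h.2] at hν
  exact ((hμ.comp_measurable measurable_fst).const_mul _).add
    ((hν.comp_measurable measurable_snd).const_mul _)

theorem IsCoupling.integral_pairSurplus {μ ν : Measure ℝ} {ρ : Measure (ℝ × ℝ)}
    (h : IsCoupling μ ν ρ) {c : ℝ} (α : ℝ) (hμ : Integrable (fun v => max (v - c) 0) μ)
    (hν : Integrable (fun v => max (v - c) 0) ν) :
    ∫ p, pairSurplus c α p.1 p.2 ∂ρ =
      (1 - α) * ∫ v, max (v - c) 0 ∂μ + α * ∫ v, max (v - c) 0 ∂ν := by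
  rw [← h.1] at hμ ⊢
  rw [← h.2] at hν ⊢
  have e1 : ∫ v, max (v - c) 0 ∂ρ.fst = ∫ p, max (p.1 - c) 0 ∂ρ :=
    integral_map measurable_fst.aemeasurable hμ.aestronglyMeasurable
  have e2 : ∫ v, max (v - c) 0 ∂ρ.snd = ∫ p, max (p.2 - c) 0 ∂ρ :=
    integral_map measurable_snd.aemeasurable hν.aestronglyMeasurable
  rw [e1, e2, ← integral_const_mul, ← integral_const_mul, ← integral_add]
  · rfl
  · exact (hμ.comp_measurable measurable_fst).const_mul _
  · exact (hν.comp_measurable measurable_snd).const_mul _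

theorem IsCoupling.integrable_pairProfit {μ ν : Measure ℝ} {ρ : Measure (ℝ × ℝ)}
    (h : IsCoupling μ ν ρ) {c α : ℝ} (hα : α ∈ Ioo (0 : ℝ) 1)
    (hμ : Integrable (fun v => max (v - c) 0) μ) (hν : Integrable (fun v => max (v - c) 0) ν) :
    Integrable (fun p : ℝ × ℝ => pairProfit c α p.1 p.2) ρ := by
  refine (h.integrable_pairSurplus α hμ hν).mono'
    (measurable_pairProfit c α).aestronglyMeasurable (.of_forall fun p => ?_)
  rw [Real.norm_of_nonneg (pairProfit_nonneg hα _ _)]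
  exact pairProfit_le_pairSurplus hα _ _

/-- Mass that a coupling must send from `s` to outside `t`. -/
theorem IsCoupling.sub_le_measureReal_prod {μ ν : Measure ℝ} {ρ : Measure (ℝ × ℝ)}
    [IsProbabilityMeasure μ] (h : IsCoupling μ ν ρ) {s t : Set ℝ} (hs : MeasurableSet s)
    (ht : MeasurableSet t) : μ.real s - ν.real t ≤ ρ.real (s ×ˢ tᶜ) := by
  have := h.isProbabilityMeasure
  have e1 : μ.real s = ρ.real (Prod.fst ⁻¹' s) := by
    rw [← h.1, measureReal_def, Measure.fst_apply hs, measureReal_def]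
  have e2 : ν.real t = ρ.real (Prod.snd ⁻¹' t) := by
    rw [← h.2, measureReal_def, Measure.snd_apply ht, measureReal_def]
  have hsub : Prod.fst ⁻¹' s ⊆ s ×ˢ tᶜ ∪ Prod.snd ⁻¹' t := by
    rintro ⟨x, y⟩ hx
    by_cases hy : y ∈ t
    · exact .inr hy
    · exact .inl ⟨hx, hy⟩
  have := (measureReal_mono (μ := ρ) hsub).trans (measureReal_union_le _ _)
  linarith

theorem exists_fst_snd_eq {μ ν : Measure ℝ} [IsFiniteMeasure μ] [IsFiniteMeasure ν]
    (h : μ univ = ν univ) : ∃ ρ : Measure (ℝ × ℝ), ρ.fst = μ ∧ ρ.snd = ν := by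
  by_cases h0 : μ univ = 0
  · refine ⟨0, ?_, ?_⟩
    · rw [Measure.measure_univ_eq_zero.1 h0]; exact Measure.map_zero _
    · rw [Measure.measure_univ_eq_zero.1 (h.symm.trans h0)]; exact Measure.map_zero _
  · refine ⟨(μ univ)⁻¹ • μ.prod ν, ?_, ?_⟩
    · rw [Measure.fst, Measure.map_smul, Measure.map_fst_prod, ← h, smul_smul,
        ENNReal.inv_mul_cancel h0 (measure_ne_top _ _), one_smul]
    · rw [Measure.snd, Measure.map_smul, Measure.map_snd_prod, smul_smul,
        ENNReal.inv_mul_cancel h0 (measure_ne_top _ _), one_smul]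

theorem exists_add_eq_of_le_univ {μ : Measure ℝ} [IsFiniteMeasure μ] {b : ENNReal}
    (hb : b ≤ μ univ) : ∃ μ₁ μ₂ : Measure ℝ, μ₁ + μ₂ = μ ∧ μ₁ univ = b := by
  by_cases h0 : μ univ = 0
  · exact ⟨0, μ, zero_add _, by simpa [h0, eq_comm] using hb⟩
  · have ht : b / μ univ ≤ 1 := ENNReal.div_le_of_le_mul (by simpa using hb)
    refine ⟨(b / μ univ) • μ, (1 - b / μ univ) • μ, ?_, ?_⟩
    · rw [← add_smul, add_tsub_cancel_of_le ht, one_smul]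
    · simp [ENNReal.div_mul_cancel h0 (measure_ne_top _ _)]

theorem abs_sub_le_tvDist (μ ν : Measure ℝ) [IsProbabilityMeasure μ] [IsProbabilityMeasure ν]
    {s : Set ℝ} (hs : MeasurableSet s) : |μ.real s - ν.real s| ≤ tvDist μ ν := by
  refine le_csSup ⟨1, ?_⟩ ⟨s, hs, rfl⟩
  rintro _ ⟨t, -, rfl⟩
  have h1 : (μ t).toReal ≤ 1 := measureReal_le_one
  have h2 : (ν t).toReal ≤ 1 := measureReal_le_one
  have h3 : 0 ≤ (μ t).toReal := ENNReal.toReal_nonneg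
  have h4 : 0 ≤ (ν t).toReal := ENNReal.toReal_nonneg
  exact abs_le.2 ⟨by linarith, by linarith⟩

theorem exists_lt_sub_of_lt_tvDist {μ ν : Measure ℝ} [IsProbabilityMeasure μ]
    [IsProbabilityMeasure ν] {r : ℝ} (h : r < tvDist μ ν) :
    ∃ s, MeasurableSet s ∧ r < μ.real s - ν.real s := by
  obtain ⟨_, ⟨s, hs, rfl⟩, hr⟩ := exists_lt_of_lt_csSup (by exact ⟨_, ∅, MeasurableSet.empty, rfl⟩) h
  rcases lt_abs.1 hr with hr | hr
  · exact ⟨s, hs, hr⟩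
  · refine ⟨sᶜ, hs.compl, ?_⟩
    rw [probReal_compl_eq_one_sub hs, probReal_compl_eq_one_sub hs]
    simp only [measureReal_def]
    linarith

/-- The part of `f` in excess of `g`, as a measure on `s`. -/
def excessMeasure (f g : ℝ → ℝ) (s : Set ℝ) : Measure ℝ :=
  (volume.restrict s).withDensity fun v => ENNReal.ofReal (f v - g v)

/-- The part common to `f` and `g`, as a measure on `s`. -/
def commonMeasure (f g : ℝ → ℝ) (s : Set ℝ) : Measure ℝ :=
  (volume.restrict s).withDensity fun v => ENNReal.ofReal (min (f v) (g v))

theorem commonMeasure_comm (f g : ℝ → ℝ) (s : Set ℝ) :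
    commonMeasure f g s = commonMeasure g f s := by
  simp only [commonMeasure, min_comm]

theorem restrict_withDensity_eq_common_add_excess {f g : ℝ → ℝ} (hf : Measurable f)
    (hg : Measurable g) (hg0 : ∀ v, 0 ≤ g v) {s : Set ℝ}
    (hs : MeasurableSet s) :
    (volume.withDensity fun v => ENNReal.ofReal (f v)).restrict s =
      commonMeasure f g s + excessMeasure f g s := by
  rw [restrict_withDensity hs, commonMeasure, excessMeasure, ← withDensity_add_left (by fun_prop)]
  congr 1
  ext v
  rw [Pi.add_apply]
  rcases le_total (f v) (g v) with h | h
  · simp [min_eq_left h, ENNReal.ofReal_of_nonpos (sub_nonpos.2 h)]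
  · rw [min_eq_right h, ← ENNReal.ofReal_add (hg0 v) (sub_nonneg.2 h), add_sub_cancel]

theorem excessMeasure_univ {f g : ℝ → ℝ} (hf : Measurable f) (hg : Measurable g)
    (hg0 : ∀ v, 0 ≤ g v) (s : Set ℝ) (hs : MeasurableSet s) :
    excessMeasure f g s univ + (volume.withDensity fun v => ENNReal.ofReal (g v))
      (s ∩ {v | g v < f v}) =
      (volume.withDensity fun v => ENNReal.ofReal (f v)) (s ∩ {v | g v < f v}) := by
  have hE : MeasurableSet {v | g v < f v} := measurableSet_lt hg hf
  rw [withDensity_apply _ (hs.inter hE), withDensity_apply _ (hs.inter hE), excessMeasure,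
    withDensity_apply _ MeasurableSet.univ, Measure.restrict_univ,
    inter_comm, ← Measure.restrict_restrict hE]
  rw [← lintegral_add_compl _ hE, setLIntegral_eq_zero (s := {v | g v < f v}ᶜ) hE.compl, add_zero,
    ← lintegral_add_left (by fun_prop)]
  · refine setLIntegral_congr_fun hE fun v hv => ?_
    have hv' : g v < f v := hv
    rw [← ENNReal.ofReal_add (sub_nonneg.2 hv'.le) (hg0 v), sub_add_cancel]
  · intro v hv
    exact ENNReal.ofReal_of_nonpos (sub_nonpos.2 (not_lt.1 hv))

theorem withDensity_apply_le_of_forall_ne {f g : ℝ → ℝ} {p : ℝ} {s : Set ℝ}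
    (hs : MeasurableSet s) (h : ∀ v ∈ s, v ≠ p → f v ≤ g v) :
    (volume.withDensity fun v => ENNReal.ofReal (f v)) s ≤
      (volume.withDensity fun v => ENNReal.ofReal (g v)) s := by
  rw [withDensity_apply _ hs, withDensity_apply _ hs]
  refine lintegral_mono_ae ?_
  filter_upwards [ae_restrict_mem hs, ae_restrict_of_ae (Measure.ae_ne volume p)] with v hv hvp
  exact ENNReal.ofReal_le_ofReal (h v hv hvp)

namespace MarketData

variable (D : MarketData)

theorem excessMeasure_le_tvDist (c : ℝ) :
    excessMeasure D.fh D.fl (Ioi c) univ ≤ ENNReal.ofReal (tvDist D.μl D.μh) := by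
  have hE : MeasurableSet (Ioi c ∩ {v | D.fl v < D.fh v}) :=
    measurableSet_Ioi.inter (measurableSet_lt D.meas_fl D.meas_fh)
  have h := excessMeasure_univ D.meas_fh D.meas_fl D.fl_nonneg (Ioi c) measurableSet_Ioi
  rw [← D.dens_l, ← D.dens_h] at h
  rw [ENNReal.eq_sub_of_add_eq (measure_ne_top _ _) h,
    ← ENNReal.ofReal_toReal (measure_ne_top D.μh _),
    ← ENNReal.ofReal_toReal (measure_ne_top D.μl _), ← ENNReal.ofReal_sub _ ENNReal.toReal_nonneg]
  refine ENNReal.ofReal_le_ofReal (le_trans ?_ (abs_sub_le_tvDist D.μl D.μh hE))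
  rw [abs_sub_comm]
  exact le_abs_self _

theorem exists_coupling_of_tvDist_le {c : ℝ} (h : tvDist D.μl D.μh ≤ D.Fl c) :
    ∃ ρ, IsCoupling D.μl D.μh ρ ∧ ∀ᵐ p ∂ρ, p.1 = p.2 ∨ p.1 ≤ c ∨ p.2 ≤ c := by
  have hl := restrict_withDensity_eq_common_add_excess D.meas_fl D.meas_fh D.fh_nonneg
    (measurableSet_Ioi (a := c))
  have hh := restrict_withDensity_eq_common_add_excess D.meas_fh D.meas_fl D.fl_nonneg
    (measurableSet_Ioi (a := c))
  rw [← D.dens_l] at hl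
  rw [← D.dens_h, commonMeasure_comm] at hh
  have hb : excessMeasure D.fh D.fl (Ioi c) univ ≤ D.μl.restrict (Iic c) univ := by
    refine (D.excessMeasure_le_tvDist c).trans ((ENNReal.ofReal_le_ofReal h).trans_eq ?_)
    simp [Fl, mCdf]
  set m := commonMeasure D.fl D.fh (Ioi c)
  set Rl := excessMeasure D.fl D.fh (Ioi c)
  set Rh := excessMeasure D.fh D.fl (Ioi c)
  have hsuml : m + Rl + D.μl.restrict (Iic c) = D.μl := by
    rw [← hl, ← compl_Iic, add_comm, Measure.restrict_add_restrict_compl measurableSet_Iic]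
  have hsumh : m + Rh + D.μh.restrict (Iic c) = D.μh := by
    rw [← hh, ← compl_Iic, add_comm, Measure.restrict_add_restrict_compl measurableSet_Iic]
  have hml : m ≤ D.μl := by rw [← hsuml, add_assoc]; exact Measure.le_add_right le_rfl
  have hRl : Rl ≤ D.μl := by
    rw [← hsuml]; exact Measure.le_add_right (Measure.le_add_left le_rfl)
  have hRh : Rh ≤ D.μh := by
    rw [← hsumh]; exact Measure.le_add_right (Measure.le_add_left le_rfl)
  have : IsFiniteMeasure m := isFiniteMeasure_of_le _ hml
  have : IsFiniteMeasure Rl := isFiniteMeasure_of_le _ hRl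
  have : IsFiniteMeasure Rh := isFiniteMeasure_of_le _ hRh
  have hmass : Rl univ + D.μl.restrict (Iic c) univ = Rh univ + D.μh.restrict (Iic c) univ := by
    rw [← ENNReal.add_right_inj (measure_ne_top m univ)]
    have e1 := congrArg (fun μ : Measure ℝ => μ univ) hsuml
    have e2 := congrArg (fun μ : Measure ℝ => μ univ) hsumh
    simp only [Measure.add_apply, measure_univ] at e1 e2 ⊢
    rw [← add_assoc, ← add_assoc, e1, e2]
  have ha : Rl univ ≤ D.μh.restrict (Iic c) univ := by
    rw [← ENNReal.add_le_add_iff_left (measure_ne_top Rh univ), ← hmass, add_comm]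
    gcongr
  obtain ⟨l₁, l₂, hl12, hl1⟩ := exists_add_eq_of_le_univ hb
  obtain ⟨h₁, h₂, hh12, hh1⟩ := exists_add_eq_of_le_univ ha
  have : IsFiniteMeasure l₁ := isFiniteMeasure_of_le (D.μl.restrict (Iic c))
    (by rw [← hl12]; exact Measure.le_add_right le_rfl)
  have : IsFiniteMeasure l₂ := isFiniteMeasure_of_le (D.μl.restrict (Iic c))
    (by rw [← hl12]; exact Measure.le_add_left le_rfl)
  have : IsFiniteMeasure h₁ := isFiniteMeasure_of_le (D.μh.restrict (Iic c))
    (by rw [← hh12]; exact Measure.le_add_right le_rfl)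
  have : IsFiniteMeasure h₂ := isFiniteMeasure_of_le (D.μh.restrict (Iic c))
    (by rw [← hh12]; exact Measure.le_add_left le_rfl)
  have h22 : l₂ univ = h₂ univ := by
    rw [← hl12, ← hh12, Measure.add_apply, Measure.add_apply, hl1, hh1, ← add_assoc, ← add_assoc,
      add_comm (Rl univ)] at hmass
    exact (ENNReal.add_right_inj (by finiteness)).1 hmass
  obtain ⟨ρ₁, f1, s1⟩ := exists_fst_snd_eq hh1.symm
  obtain ⟨ρ₂, f2, s2⟩ := exists_fst_snd_eq hl1
  obtain ⟨ρ₃, f3, s3⟩ := exists_fst_snd_eq h22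
  have hlc : ∀ᵐ v ∂D.μl.restrict (Iic c), v ≤ c := ae_restrict_mem measurableSet_Iic
  have hhc : ∀ᵐ v ∂D.μh.restrict (Iic c), v ≤ c := ae_restrict_mem measurableSet_Iic
  rw [← hl12, ae_add_measure_iff] at hlc
  rw [← hh12, ae_add_measure_iff] at hhc
  have hdiag : Measurable fun v : ℝ => (v, v) := by fun_prop
  refine ⟨m.map (fun v => (v, v)) + ρ₁ + ρ₂ + ρ₃, ⟨?_, ?_⟩, ?_⟩
  · simp only [Measure.fst_add, f1, f2, f3]
    rw [Measure.fst, Measure.map_map measurable_fst hdiag,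
      show Prod.fst ∘ (fun v : ℝ => (v, v)) = id from rfl, Measure.map_id, add_assoc, hl12, hsuml]
  · simp only [Measure.snd_add, s1, s2, s3]
    rw [Measure.snd, Measure.map_map measurable_snd hdiag,
      show Prod.snd ∘ (fun v : ℝ => (v, v)) = id from rfl, Measure.map_id, add_right_comm m,
      add_assoc (m + Rh), hh12, hsumh]
  · simp only [ae_add_measure_iff]
    refine ⟨⟨⟨?_, ?_⟩, ?_⟩, ?_⟩
    · rw [ae_map_iff hdiag.aemeasurable]
      · simp
      · measurability
    · rw [← s1] at hhc
      filter_upwards [ae_of_ae_map measurable_snd.aemeasurable hhc.1] with p hp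
      exact .inr (.inr hp)
    · rw [← f2] at hlc
      filter_upwards [ae_of_ae_map measurable_fst.aemeasurable hlc.1] with p hp
      exact .inr (.inl hp)
    · rw [← f3] at hlc
      filter_upwards [ae_of_ae_map measurable_fst.aemeasurable hlc.2] with p hp
      exact .inr (.inl hp)

theorem fl_eq_zero_of_not_mem {v : ℝ} (hv : ¬(D.vlo < v ∧ (v : EReal) < D.vhi)) : D.fl v = 0 :=
  (D.fl_nonneg v).antisymm' (not_lt.1 fun h => hv ((D.fl_pos_iff v).1 h))

theorem fh_eq_zero_of_not_mem {v : ℝ} (hv : ¬(D.vlo < v ∧ (v : EReal) < D.vhi)) : D.fh v = 0 :=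
  (D.fh_nonneg v).antisymm' (not_lt.1 fun h => hv ((D.fh_pos_iff v).1 h))

/-- The monotone likelihood ratio property in product form, valid on the whole line. -/
theorem fh_mul_fl_le {v w : ℝ} (hvw : v ≤ w) : D.fh v * D.fl w ≤ D.fh w * D.fl v := by
  by_cases hv : D.vlo < v ∧ (v : EReal) < D.vhi
  · by_cases hw : D.vlo < w ∧ (w : EReal) < D.vhi
    · have := D.lr_strictMono.monotoneOn hv hw hvw
      rwa [div_le_div_iff₀ ((D.fl_pos_iff v).2 hv) ((D.fl_pos_iff w).2 hw)] at this
    · simp [D.fl_eq_zero_of_not_mem hw, D.fh_eq_zero_of_not_mem hw]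
  · simp [D.fl_eq_zero_of_not_mem hv, D.fh_eq_zero_of_not_mem hv]

theorem integrable_max_sub_h (hmom : Integrable (fun v : ℝ => v) D.μh) (c : ℝ) :
    Integrable (fun v => max (v - c) 0) D.μh :=
  (hmom.sub (integrable_const c)).pos_part

theorem integrable_max_sub_l (hmom : Integrable (fun v : ℝ => v) D.μh) (c : ℝ) :
    Integrable (fun v => max (v - c) 0) D.μl := by
  obtain ⟨w, hw1, hw2⟩ := EReal.lt_iff_exists_real_btwn.1 D.vlo_lt_vhi
  have hw : D.vlo < w ∧ (w : EReal) < D.vhi := ⟨EReal.coe_lt_coe_iff.1 hw1, hw2⟩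
  have hl0 := (D.fl_pos_iff w).2 hw
  have hh0 := (D.fh_pos_iff w).2 hw
  rw [← integrableOn_univ, ← Iic_union_Ioi (a := w)]
  refine IntegrableOn.union ?_ ?_
  · refine Integrable.of_bound (by fun_prop) (max (w - c) 0) ?_
    filter_upwards [ae_restrict_mem measurableSet_Iic] with v hv
    rw [Real.norm_of_nonneg (le_max_right _ _)]
    have hv' : v ≤ w := hv
    gcongr
  · have hle : D.μl.restrict (Ioi w) ≤ ENNReal.ofReal (D.fl w / D.fh w) • D.μh := by
      rw [D.dens_l, D.dens_h, restrict_withDensity measurableSet_Ioi, ← withDensity_smul _ (by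
        have := D.meas_fh
        fun_prop), ← withDensity_indicator measurableSet_Ioi]
      refine withDensity_mono (.of_forall fun v => ?_)
      by_cases hv : v ∈ Ioi w
      · rw [indicator_of_mem hv, Pi.smul_apply, smul_eq_mul, ← ENNReal.ofReal_mul (by positivity)]
        refine ENNReal.ofReal_le_ofReal ?_
        rw [div_mul_eq_mul_div, le_div_iff₀ hh0]
        have := D.fh_mul_fl_le (le_of_lt hv)
        linarith
      · rw [indicator_of_notMem hv]
        exact bot_le
    exact ((D.integrable_max_sub_h hmom c).smul_measure ENNReal.ofReal_ne_top).mono_measure hle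

/-- The densities cross once, so half-lines maximize `μ_l - μ_h`. -/
theorem exists_sub_le_Δ {s : Set ℝ} (hs : MeasurableSet s) (h : 0 < D.μl.real s - D.μh.real s) :
    ∃ p, D.μl.real s - D.μh.real s ≤ D.Δ p := by
  have hmono_lh {t : Set ℝ} (p : ℝ) (ht : MeasurableSet t)
      (hp : ∀ v ∈ t, v ≠ p → D.fl v ≤ D.fh v) : D.μl.real t ≤ D.μh.real t := by
    refine ENNReal.toReal_mono (measure_ne_top _ _) ?_
    rw [D.dens_l, D.dens_h]
    exact withDensity_apply_le_of_forall_ne ht hp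
  have hmono_hl {t : Set ℝ} (p : ℝ) (ht : MeasurableSet t)
      (hp : ∀ v ∈ t, v ≠ p → D.fh v ≤ D.fl v) : D.μh.real t ≤ D.μl.real t := by
    refine ENNReal.toReal_mono (measure_ne_top _ _) ?_
    rw [D.dens_l, D.dens_h]
    exact withDensity_apply_le_of_forall_ne ht hp
  obtain ⟨u, hu⟩ : ∃ u, D.fh u < D.fl u := by
    by_contra! hcon
    linarith [hmono_lh 0 hs fun v _ _ => hcon v]
  obtain ⟨w, hw⟩ : ∃ w, D.fl w < D.fh w := by
    by_contra! hcon
    have := hmono_hl 0 hs.compl fun v _ _ => hcon v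
    rw [probReal_compl_eq_one_sub hs, probReal_compl_eq_one_sub hs] at this
    linarith
  have hbdd : BddAbove {v | D.fh v < D.fl v} := by
    refine ⟨w, fun v hv => ?_⟩
    by_contra! hwv
    have hv' : D.fh v < D.fl v := hv
    have := D.fh_mul_fl_le hwv.le
    nlinarith [D.fl_nonneg w, D.fh_nonneg v]
  set p := sSup {v | D.fh v < D.fl v}
  have hgt {v : ℝ} (hv : p < v) : D.fl v ≤ D.fh v := not_lt.1 fun h => hv.not_ge (le_csSup hbdd h)
  have hlt {v : ℝ} (hv : v < p) : D.fh v ≤ D.fl v := by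
    obtain ⟨x, hx, hvx⟩ := exists_lt_of_lt_csSup ⟨u, hu⟩ hv
    have hx' : D.fh x < D.fl x := hx
    have := D.fh_mul_fl_le hvx.le
    by_contra! hcon
    nlinarith [D.fl_nonneg v, D.fh_nonneg x]
  refine ⟨p, ?_⟩
  have h1 : D.μl.real (s \ Iic p) ≤ D.μh.real (s \ Iic p) :=
    hmono_lh p (hs.diff measurableSet_Iic) fun v hv _ => hgt (not_le.1 hv.2)
  have h2 : D.μh.real (Iic p \ s) ≤ D.μl.real (Iic p \ s) :=
    hmono_hl p (measurableSet_Iic.diff hs) fun v hv hvp => hlt (lt_of_le_of_ne hv.1 hvp)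
  have e1 := measureReal_inter_add_sdiff (μ := D.μl) (s := s) (measurableSet_Iic (a := p))
  have e2 := measureReal_inter_add_sdiff (μ := D.μh) (s := s) (measurableSet_Iic (a := p))
  have e3 := measureReal_inter_add_sdiff (μ := D.μl) (s := Iic p) hs
  have e4 := measureReal_inter_add_sdiff (μ := D.μh) (s := Iic p) hs
  rw [inter_comm] at e3 e4
  change _ ≤ D.μl.real (Iic p) - D.μh.real (Iic p)
  linarith

theorem exists_Icc_of_lt_tvDist {c : ℝ} (h : D.Fl c < tvDist D.μl D.μh) :
    ∃ a b p, c < a ∧ b < p ∧ 0 < D.μl.real (Icc a b) - D.μh.real (Iic p) := by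
  obtain ⟨s, hs, hlt⟩ := exists_lt_sub_of_lt_tvDist h
  have hFl0 : 0 ≤ D.Fl c := ENNReal.toReal_nonneg
  obtain ⟨p, hp⟩ := D.exists_sub_le_Δ hs (hFl0.trans_lt hlt)
  have hΔ : D.Fl c < D.μl.real (Iic p) - D.μh.real (Iic p) := hlt.trans_le hp
  have hIoo : D.μh (Iic p) < D.μl (Ioo c p) := by
    have hsub : Iic p ⊆ Iic c ∪ Ioo c p ∪ {p} := by
      intro v hv
      rcases le_or_gt v c with h | h
      · exact .inl (.inl h)
      · rcases lt_or_eq_of_le (mem_Iic.1 hv) with h' | h'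
        · exact .inl (.inr ⟨h, h'⟩)
        · exact .inr h'
    have h0 : D.μl.real {p} = 0 := by
      have : D.μl {p} = 0 := by
        rw [D.dens_l]
        exact withDensity_absolutelyContinuous _ _ (by simp)
      simp [measureReal_def, this]
    have h1 := measureReal_mono (μ := D.μl) hsub
    have h2 := measureReal_union_le (μ := D.μl) (Iic c ∪ Ioo c p) {p}
    have h3 := measureReal_union_le (μ := D.μl) (Iic c) (Ioo c p)
    have h4 : D.Fl c = D.μl.real (Iic c) := rfl
    rw [← ENNReal.toReal_lt_toReal (measure_ne_top _ _) (measure_ne_top _ _)]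
    change D.μh.real _ < D.μl.real _
    linarith
  obtain ⟨K, hKsub, hK, hlt⟩ := isOpen_Ioo.exists_lt_isCompact hIoo
  have hne : K.Nonempty := by
    rw [nonempty_iff_ne_empty]
    rintro rfl
    simp at hlt
  obtain ⟨a, ha, hal⟩ := hK.exists_isLeast hne
  obtain ⟨b, hb, hbg⟩ := hK.exists_isGreatest hne
  refine ⟨a, b, p, (hKsub ha).1, (hKsub hb).2, sub_pos.2 ?_⟩
  refine (ENNReal.toReal_lt_toReal (measure_ne_top _ _) (measure_ne_top _ _)).2 ?_
  exact hlt.trans_le (measure_mono fun v hv => ⟨hal hv, hbg hv⟩)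

end MarketData

/-- full surplus extraction via matched pairs is possible, i.e. the
supremum of `∫ π dρ` over couplings equals the total gains from trade
`(1−α)·∫ (v−c)⁺ dμ_l + α·∫ (v−c)⁺ dμ_h`, if and only if `F_l(c) ≥ ‖F_l − F_h‖`. -/
theorem stmt9 (D : MarketData) (c α : ℝ) (hc : 0 ≤ c) (hα : α ∈ Ioo (0 : ℝ) 1)
    (hmom : Integrable (fun v : ℝ => v) D.μh) :
    sSup (couplingValues D.μl D.μh c α) =
        (1 - α) * ∫ v, max (v - c) 0 ∂D.μl + α * ∫ v, max (v - c) 0 ∂D.μh ↔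
      tvDist D.μl D.μh ≤ D.Fl c := by
  have hil := D.integrable_max_sub_l hmom c
  have hih := D.integrable_max_sub_h hmom c
  constructor
  · intro hsup
    by_contra! hlt
    obtain ⟨a, b, p, hca, hbp, hpos⟩ := D.exists_Icc_of_lt_tvDist hlt
    set δ := min (α * (p - b)) ((1 - α) * (a - c))
    have hδ : 0 < δ :=
      lt_min (mul_pos hα.1 (sub_pos.2 hbp)) (mul_pos (sub_pos.2 hα.2) (sub_pos.2 hca))
    have hle : sSup (couplingValues D.μl D.μh c α) ≤
        (1 - α) * ∫ v, max (v - c) 0 ∂D.μl + α * ∫ v, max (v - c) 0 ∂D.μh -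
          (D.μl.real (Icc a b) - D.μh.real (Iic p)) * δ := by
      refine csSup_le ⟨_, D.μl.prod D.μh, ⟨Measure.fst_prod, Measure.snd_prod⟩, rfl⟩ ?_
      rintro _ ⟨ρ, hρ, rfl⟩
      have := hρ.isProbabilityMeasure
      have hmass := hρ.sub_le_measureReal_prod (measurableSet_Icc (a := a) (b := b))
        (measurableSet_Iic (a := p))
      have hset : MeasurableSet (Icc a b ×ˢ (Iic p)ᶜ) :=
        measurableSet_Icc.prod measurableSet_Iic.compl
      have hind : Integrable ((Icc a b ×ˢ (Iic p)ᶜ).indicator fun _ => δ) ρ :=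
        (integrable_const δ).indicator hset
      have hint := hρ.integrable_pairProfit hα hil hih
      have hmono := integral_mono (hint.add hind) (hρ.integrable_pairSurplus α hil hih) fun q => by
        by_cases hq : q ∈ Icc a b ×ˢ (Iic p)ᶜ
        · simp only [Pi.add_apply, indicator_of_mem hq]
          exact pairProfit_add_le_pairSurplus hα hca hq.1 hbp (not_le.1 hq.2)
        · simp only [Pi.add_apply, indicator_of_notMem hq, add_zero]
          exact pairProfit_le_pairSurplus hα _ _
      rw [integral_add' hint hind, hρ.integral_pairSurplus α hil hih,
        integral_indicator_const δ hset, smul_eq_mul] at hmono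
      linarith [mul_le_mul_of_nonneg_right hmass hδ.le]
    linarith [mul_pos hpos hδ]
  · intro h
    obtain ⟨ρ, hρ, hae⟩ := D.exists_coupling_of_tvDist_le h
    refine IsGreatest.csSup_eq ⟨⟨ρ, hρ, ?_⟩, ?_⟩
    · rw [← hρ.integral_pairSurplus α hil hih]
      refine integral_congr_ae ?_
      filter_upwards [hae] with q hq
      exact (pairProfit_eq_pairSurplus hα hq).symm
    · rintro _ ⟨ρ', hρ', rfl⟩
      rw [← hρ'.integral_pairSurplus α hil hih]
      exact integral_mono (hρ'.integrable_pairProfit hα hil hih)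
        (hρ'.integrable_pairSurplus α hil hih) fun q => pairProfit_le_pairSurplus hα _ _
end
end
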